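/- Transformation law of the generalized Dedekind eta function (slice form of Theorem 4.20): let d ≥ 1 and let A be an invertible real d×d matrix whose lattice L = A·ℤ^d is self-dual, and fix q̃ = (1/2)·A·m₀ for some m₀ ∈ ℤ^d. Define, for Im z > 0, η_q̃(z) = θ(z)·θ̃_q̃(z)·θ̃̃_q̃(z), where θ(z) = ∑_{m∈ℤ^d} exp(πi‖Am‖²·z), θ̃_q̃(z) = ∑_{m∈ℤ^d} exp(πi‖Am‖²·z + 2πi⟨Am, q̃⟩), and θ̃̃_q̃(z) = ∑_{m∈ℤ^d} exp(πi‖Am + q̃‖²·z). Then for every z with Im z > 0: η_q̃(z) = (−iz)^{−3d/2} · η_q̃(−z⁻¹). -/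

import Mathlib

open Matrix

open MeasureTheory in
/-- Integrating over `ℝ^ι` amounts to summing the integrals over integer translates of the
unit box. -/
theorem hasSum_setIntegral_unitBox_add_int {ι : Type*} [Fintype ι] {g : (ι → ℝ) → ℂ}
    (hg : Integrable g) :
    HasSum (fun m : ι → ℤ => ∫ x : ι → ℝ in {x | ∀ i, x i ∈ Set.Ioc (0 : ℝ) (0 + 1)},
      g (x + fun i => (m i : ℝ))) (∫ x, g x) := by
  let S : (ι → ℤ) → Set (ι → ℝ) := fun m => {x | ∀ i, x i ∈ Set.Ioc (m i : ℝ) (m i + 1)}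
  have hSm (m : ι → ℤ) : MeasurableSet (S m) := by
    have : S m = Set.univ.pi fun i => Set.Ioc (m i : ℝ) (m i + 1) := by
      ext x; simp [S]
    rw [this]
    exact MeasurableSet.univ_pi fun i => measurableSet_Ioc
  have hceil {m : ι → ℤ} {x : ι → ℝ} (hx : x ∈ S m) : m = fun i => ⌈x i⌉ - 1 := by
    funext i
    have h : ⌈x i⌉ = m i + 1 := by
      rw [Int.ceil_eq_iff]
      push_cast
      exact ⟨by linarith [(hx i).1], (hx i).2⟩
    omega
  have hdisj : Pairwise (Function.onFun Disjoint S) := fun m n hmn =>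
    Set.disjoint_left.mpr fun x hm hn => hmn ((hceil hm).trans (hceil hn).symm)
  have hun : ⋃ m, S m = Set.univ := by
    refine Set.eq_univ_of_forall fun x => Set.mem_iUnion.mpr ⟨fun i => ⌈x i⌉ - 1, fun i => ?_⟩
    push_cast
    exact ⟨by linarith [Int.ceil_lt_add_one (x i)], by linarith [Int.le_ceil (x i)]⟩
  have key := hasSum_integral_iUnion hSm hdisj hg.integrableOn
  rw [hun, setIntegral_univ] at key
  refine key.congr_fun fun m => ?_
  rw [← (measurePreserving_add_right volume fun i => (m i : ℝ)).setIntegral_preimage_emb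
    (measurableEmbedding_addRight _) g (S m)]
  congr 2
  ext x
  refine forall_congr' fun i => ?_
  simp only [Set.mem_Ioc, Pi.add_apply]
  constructor <;> rintro ⟨h₁, h₂⟩ <;> constructor <;> linarith

theorem UnitAddTorus.mFourier_coe_apply {ι : Type*} [Fintype ι] (n : ι → ℤ) (x : ι → ℝ) :
    UnitAddTorus.mFourier n (fun i => (x i : UnitAddCircle)) =
      Complex.exp (2 * Real.pi * Complex.I * ∑ i, (n i : ℂ) * x i) := by
  simp only [UnitAddTorus.mFourier, ContinuousMap.coe_mk, fourier_coe_apply, Finset.mul_sum,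
    Complex.exp_sum]
  refine Finset.prod_congr rfl fun i _ => ?_
  congr 1
  push_cast
  ring

open MeasureTheory in
/-- **Poisson summation** on `ℝ^ι`, for a continuous integrable function whose integer translates
are summable uniformly on bounded sets and whose Fourier transform is summable on `ℤ^ι`. -/
theorem tsum_add_int_eq_tsum_fourier {ι : Type*} [Fintype ι] {f : (ι → ℝ) → ℂ}
    (hc : Continuous f) (hi : Integrable f)
    (hb : ∀ R : ℝ, ∃ u : (ι → ℤ) → ℝ, Summable u ∧
      ∀ m x, ‖x‖ ≤ R → ‖f (x + fun i => (m i : ℝ))‖ ≤ u m)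
    {c : (ι → ℤ) → ℂ}
    (hcoeff : ∀ n, ∫ x, Complex.exp (2 * Real.pi * Complex.I * ∑ i, ((-n) i : ℂ) * x i) * f x = c n)
    (hs : Summable c) (x : ι → ℝ) :
    ∑' m : ι → ℤ, f (x + fun i => (m i : ℝ)) =
      ∑' n : ι → ℤ, c n * Complex.exp (2 * Real.pi * Complex.I * ∑ i, (n i : ℂ) * x i) := by
  let F : C(ι → ℝ, ℂ) := ⟨fun x => ∑' m : ι → ℤ, f (x + fun i => (m i : ℝ)), by
    refine continuous_iff_continuousAt.mpr fun y => ?_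
    obtain ⟨u, hu, hfu⟩ := hb (‖y‖ + 1)
    refine (continuousOn_tsum (s := Metric.closedBall 0 (‖y‖ + 1)) (fun m => ?_) hu
      fun m x hx => hfu m x (by simpa using hx)).continuousAt ?_
    · exact (hc.comp (by fun_prop)).continuousOn
    · exact Metric.closedBall_mem_nhds_of_mem (by simp)⟩
  have hper (y : ι → ℝ) (k : ι → ℤ) : F (y + fun i => (k i : ℝ)) = F y := by
    change ∑' m : ι → ℤ, f _ = ∑' m : ι → ℤ, f _
    rw [← (Equiv.addLeft k).tsum_eq fun m : ι → ℤ => f (y + fun i => (m i : ℝ))]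
    refine tsum_congr fun m => congrArg f ?_
    funext i
    simp [add_assoc]
  have hq : IsOpenQuotientMap (Pi.map fun (_ : ι) (t : ℝ) => (t : UnitAddCircle)) :=
    IsOpenQuotientMap.piMap fun _ => QuotientAddGroup.isOpenQuotientMap_mk
  let p : C(ι → ℝ, UnitAddTorus ι) := ⟨_, hq.continuous⟩
  have hp : Topology.IsQuotientMap p := hq.isQuotientMap
  have hfac : Function.FactorsThrough F p := by
    intro a b hab
    have h (i : ι) : ∃ k : ℤ, (k : ℝ) = a i - b i := by
      have h₁ : ((a i - b i : ℝ) : UnitAddCircle) = 0 := by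
        rw [AddCircle.coe_sub, sub_eq_zero]
        exact congrFun hab i
      obtain ⟨k, hk⟩ := (AddCircle.coe_eq_zero_iff 1).mp h₁
      exact ⟨k, by simpa using hk⟩
    choose k hk using h
    rw [← hper b k]
    congr 1
    funext i
    simp [hk]
  let G : C(UnitAddTorus ι, ℂ) := hp.lift F hfac
  have hG (y : ι → ℝ) : G (fun i => (y i : UnitAddCircle)) = F y :=
    congrFun (congrArg DFunLike.coe (hp.lift_comp F hfac)) y
  have hGc : UnitAddTorus.mFourierCoeff G = c := by
    funext n
    rw [UnitAddTorus.mFourierCoeff_eq_integral _ _ 0]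
    set e : (ι → ℝ) → ℂ := fun y => UnitAddTorus.mFourier (-n) fun i => (y i : UnitAddCircle)
    have hec : Continuous e := (map_continuous _).comp hq.continuous
    have he (y : ι → ℝ) : ‖e y‖ ≤ 1 :=
      ((UnitAddTorus.mFourier (-n)).norm_coe_le_norm _).trans_eq UnitAddTorus.mFourier_norm
    have heper (y : ι → ℝ) (k : ι → ℤ) : e (y + fun i => (k i : ℝ)) = e y := by
      refine congrArg (UnitAddTorus.mFourier (-n)) (funext fun i => ?_)
      rw [Pi.add_apply, AddCircle.coe_add, add_eq_left]
      exact (AddCircle.coe_eq_zero_iff 1).mpr ⟨k i, by simp⟩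
    have hunfold := hasSum_setIntegral_unitBox_add_int (g := fun y => e y * f y)
      (hi.bdd_mul (c := 1) hec.aestronglyMeasurable (.of_forall he))
    have hcn : ∫ y, e y * f y = c n := by
      simp_rw [← hcoeff, e, UnitAddTorus.mFourier_coe_apply]
    rw [hcn] at hunfold
    obtain ⟨u, hu, hfu⟩ := hb 1
    refine HasSum.unique ?_ hunfold
    have hbox : {x : ι → ℝ | ∀ i, x i ∈ Set.Ioc (0 : ℝ) (0 + 1)} =
        Set.univ.pi fun _ => Set.Ioc (0 : ℝ) (0 + 1) := by
      ext; simp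
    have hboxm : MeasurableSet {x : ι → ℝ | ∀ i, x i ∈ Set.Ioc (0 : ℝ) (0 + 1)} := by
      rw [hbox]
      exact MeasurableSet.univ_pi fun _ => measurableSet_Ioc
    have hnorm {y : ι → ℝ} (hy : y ∈ {x : ι → ℝ | ∀ i, x i ∈ Set.Ioc (0 : ℝ) (0 + 1)}) :
        ‖y‖ ≤ 1 := by
      refine (pi_norm_le_iff_of_nonneg zero_le_one).mpr fun i => ?_
      rw [Real.norm_eq_abs, abs_le]
      constructor <;> linarith [(hy i).1, (hy i).2]
    have hbound (m : ι → ℤ) {y : ι → ℝ} (hy : ‖y‖ ≤ 1) :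
        ‖e (y + fun i => (m i : ℝ)) * f (y + fun i => (m i : ℝ))‖ ≤ u m := by
      rw [norm_mul]
      exact (mul_le_of_le_one_left (norm_nonneg _) (he _)).trans (hfu m y hy)
    refine hasSum_integral_of_dominated_convergence (fun m _ => u m) (fun m => ?_) (fun m => ?_)
      (.of_forall fun _ => hu) ?_ ?_
    · exact ((hec.mul hc).comp (by fun_prop)).aestronglyMeasurable
    · filter_upwards [ae_restrict_mem hboxm] with y hy using hbound m (hnorm hy)
    · refine integrableOn_const ?_
      rw [hbox, Real.volume_pi_Ioc]
      simp
    · filter_upwards [ae_restrict_mem hboxm] with y hy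
      simp_rw [heper]
      rw [hG, smul_eq_mul]
      exact (Summable.of_norm_bounded hu fun m => hfu m y (hnorm hy)).hasSum.mul_left (e y)
  have key := (UnitAddTorus.hasSum_mFourier_series_apply_of_summable (hGc ▸ hs)
    fun i => (x i : UnitAddCircle)).tsum_eq
  rw [hG] at key
  simp_rw [hGc, UnitAddTorus.mFourier_coe_apply, smul_eq_mul] at key
  exact key.symm

theorem summable_exp_neg_mul_sum_sq {ι : Type*} [Fintype ι] {a : ℝ} (ha : 0 < a) :
    Summable fun m : ι → ℤ => Real.exp (-a * ∑ i, (m i : ℝ) ^ 2) := by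
  classical
  have h₁ : Summable fun k : ℤ => Real.exp (-a * (k : ℝ) ^ 2) := by
    have h := ((summable_jacobiTheta₂_term_iff 0 (a / Real.pi * Complex.I)).mpr (by
      simp only [Complex.mul_I_im]
      rw [← Complex.ofReal_div, Complex.ofReal_re]
      positivity)).norm
    refine h.congr fun k => ?_
    rw [norm_jacobiTheta₂_term, ← Complex.ofReal_div, Complex.mul_I_im, Complex.ofReal_re]
    congr 1
    simp
    field_simp
  refine summable_of_sum_le (c := (∑' k : ℤ, Real.exp (-a * (k : ℝ) ^ 2)) ^ Fintype.card ι)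
    (fun m => (Real.exp_pos _).le) fun s => ?_
  let T : ι → Finset ℤ := fun i => s.image fun m => m i
  calc ∑ m ∈ s, Real.exp (-a * ∑ i, (m i : ℝ) ^ 2)
      ≤ ∑ m ∈ Fintype.piFinset T, Real.exp (-a * ∑ i, (m i : ℝ) ^ 2) :=
        Finset.sum_le_sum_of_subset_of_nonneg
          (fun m hm => Fintype.mem_piFinset.mpr fun i => Finset.mem_image_of_mem _ hm)
          fun _ _ _ => (Real.exp_pos _).le
    _ = ∏ i : ι, ∑ k ∈ T i, Real.exp (-a * (k : ℝ) ^ 2) := by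
        rw [Finset.prod_univ_sum]
        simp_rw [Finset.mul_sum, Real.exp_sum]
    _ ≤ ∏ _i : ι, ∑' k : ℤ, Real.exp (-a * (k : ℝ) ^ 2) :=
        Finset.prod_le_prod (fun _ _ => Finset.sum_nonneg fun _ _ => (Real.exp_pos _).le)
          fun _ _ => h₁.sum_le_tsum _ fun _ _ => (Real.exp_pos _).le
    _ = _ := by simp

theorem exists_pos_mul_sum_sq_le_sum_mulVec_sq {ι : Type*} [Fintype ι] [DecidableEq ι]
    {A : Matrix ι ι ℝ} (hA : IsUnit A.det) :
    ∃ c > 0, ∀ y : ι → ℝ, c * ∑ i, y i ^ 2 ≤ ∑ i, (A.mulVec y i) ^ 2 := by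
  have hC : 0 ≤ ∑ i, ∑ j, A⁻¹ i j ^ 2 := by positivity
  refine ⟨(∑ i, ∑ j, A⁻¹ i j ^ 2 + 1)⁻¹, by positivity, fun y => ?_⟩
  rw [inv_mul_le_iff₀ (by positivity)]
  have h : ∑ i, y i ^ 2 ≤ (∑ i, ∑ j, A⁻¹ i j ^ 2) * ∑ j, (A.mulVec y j) ^ 2 := by
    rw [Finset.sum_mul]
    refine Finset.sum_le_sum fun i _ => ?_
    have hy : y i = ∑ j, A⁻¹ i j * A.mulVec y j := by
      change y i = (A⁻¹.mulVec (A.mulVec y)) i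
      rw [Matrix.mulVec_mulVec, Matrix.nonsing_inv_mul _ hA, Matrix.one_mulVec]
    rw [hy]
    exact Finset.sum_mul_sq_le_sq_mul_sq _ _ _
  have h' : 0 ≤ ∑ i, (A.mulVec y i) ^ 2 := by positivity
  linarith

theorem exists_summable_bound_exp_neg_sum_mulVec_sq {ι : Type*} [Fintype ι] [DecidableEq ι]
    {A : Matrix ι ι ℝ} (hA : IsUnit A.det) {t : ℝ} (ht : 0 < t) (R : ℝ) :
    ∃ u : (ι → ℤ) → ℝ, Summable u ∧ ∀ m x, ‖x‖ ≤ R →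
      Real.exp (-t * ∑ j, (A.mulVec (x + fun i => (m i : ℝ)) j) ^ 2) ≤ u m := by
  obtain ⟨c, hc, hcA⟩ := exists_pos_mul_sum_sq_le_sum_mulVec_sq hA
  refine ⟨fun m => Real.exp (t * c * (Fintype.card ι * R ^ 2)) *
    Real.exp (-(t * c / 2) * ∑ i, (m i : ℝ) ^ 2),
    (summable_exp_neg_mul_sum_sq (by positivity)).mul_left _, fun m x hx => ?_⟩
  beta_reduce
  rw [← Real.exp_add, Real.exp_le_exp]
  have h : ∑ i, (m i : ℝ) ^ 2 / 2 ≤ ∑ i, ((x i + m i) ^ 2 + R ^ 2) := by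
    refine Finset.sum_le_sum fun i _ => ?_
    have hxi : |x i| ≤ R := (norm_le_pi_norm x i).trans hx
    have : x i ^ 2 ≤ R ^ 2 := sq_le_sq' (by linarith [(abs_le.mp hxi).1]) (abs_le.mp hxi).2
    nlinarith [sq_nonneg (2 * x i + m i)]
  rw [← Finset.sum_div, Finset.sum_add_distrib, Finset.sum_const, nsmul_eq_mul,
    Finset.card_univ] at h
  have h₂ := mul_le_mul_of_nonneg_left (hcA (x + fun i => (m i : ℝ))) ht.le
  have h₃ := mul_le_mul_of_nonneg_left h (mul_pos ht hc).le
  simp only [Pi.add_apply] at h₂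
  linarith

theorem norm_exp_pi_mul_I_mul_ofReal_mul (s : ℝ) (z : ℂ) :
    ‖Complex.exp ((Real.pi : ℂ) * Complex.I * (s : ℂ) * z)‖ = Real.exp (-(Real.pi * z.im) * s) := by
  rw [Complex.norm_exp]
  congr 1
  simp
  ring

open MeasureTheory in
/-- Poisson summation for Gaussians on a lattice of covolume one. -/
theorem tsum_exp_mulVec_sq_eq {ι : Type*} [Fintype ι] [DecidableEq ι]
    {A : Matrix ι ι ℝ} (hA : |A.det| = 1) {z : ℂ} (hz : 0 < z.im) (x : ι → ℝ) :
    ∑' m : ι → ℤ, Complex.exp ((Real.pi : ℂ) * Complex.I *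
        ((∑ j, (A.mulVec (x + fun i => (m i : ℝ)) j) ^ 2 : ℝ) : ℂ) * z) =
      (-Complex.I * z) ^ (-(Fintype.card ι : ℂ) / 2) *
        ∑' n : ι → ℤ, Complex.exp ((Real.pi : ℂ) * Complex.I *
            ((∑ j, ((Aᵀ)⁻¹.mulVec (fun i => (n i : ℝ)) j) ^ 2 : ℝ) : ℂ) * (-z⁻¹) +
          2 * (Real.pi : ℂ) * Complex.I *
            ((∑ j, (Aᵀ)⁻¹.mulVec (fun i => (n i : ℝ)) j * A.mulVec x j : ℝ) : ℂ)) := by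
  have hdet : A.det ≠ 0 := by
    rintro h
    simp [h] at hA
  have hAu : IsUnit A.det := hdet.isUnit
  have hBu : IsUnit ((Aᵀ)⁻¹).det := by
    rw [Matrix.isUnit_nonsing_inv_det_iff, Matrix.det_transpose]
    exact hAu
  have hz0 : z ≠ 0 := by
    rintro rfl
    simp at hz
  have hzinv : 0 < (-z⁻¹).im := by
    rw [Complex.neg_im, Complex.inv_im, neg_div, neg_neg]
    exact div_pos hz (Complex.normSq_pos.mpr hz0)
  have hb : 0 < (-(Real.pi * Complex.I * z)).re := by
    simpa using mul_pos Real.pi_pos hz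
  have hadj (v w : ι → ℝ) : ∑ j, (Aᵀ)⁻¹.mulVec v j * A.mulVec w j = ∑ i, v i * w i := by
    change (Aᵀ)⁻¹.mulVec v ⬝ᵥ A.mulVec w = v ⬝ᵥ w
    rw [Matrix.dotProduct_mulVec, ← Matrix.mulVec_transpose, Matrix.mulVec_mulVec,
      Matrix.mul_nonsing_inv _ (by rwa [Matrix.det_transpose]), Matrix.one_mulVec]
  have hmp : MeasurePreserving (fun y : ι → ℝ => A.mulVec y) := by
    refine ⟨by fun_prop, ?_⟩
    have := Real.map_matrix_volume_pi_eq_smul_volume_pi hdet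
    rw [abs_inv, hA] at this
    rw [inv_one, ENNReal.ofReal_one, one_smul] at this
    exact this
  have hme : MeasurableEmbedding (fun y : ι → ℝ => A.mulVec y) :=
    Continuous.measurableEmbedding (by fun_prop)
      (Matrix.mulVec_injective_of_isUnit ((Matrix.isUnit_iff_isUnit_det A).mpr hAu))
  let g : (ι → ℤ) → (ι → ℝ) → ℂ := fun n v =>
    Complex.exp (-(-(Real.pi * Complex.I * z)) * ∑ i, (v i : ℂ) ^ 2 +
      ∑ i, (-2 * Real.pi * Complex.I * ((Aᵀ)⁻¹.mulVec (fun i => (n i : ℝ)) i : ℝ)) * v i)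
  let f : (ι → ℝ) → ℂ := fun y =>
    Complex.exp (Real.pi * Complex.I * ((∑ j, (A.mulVec y j) ^ 2 : ℝ) : ℂ) * z)
  have hgf (n : ι → ℤ) (y : ι → ℝ) :
      Complex.exp (2 * Real.pi * Complex.I * ∑ i, ((-n) i : ℂ) * y i) * f y =
        g n (A.mulVec y) := by
    have h := congrArg (fun r : ℝ => (r : ℂ)) (hadj (fun i => (n i : ℝ)) y)
    push_cast at h
    simp only [f, g, ← Complex.exp_add]
    congr 1
    simp_rw [mul_assoc, ← Finset.mul_sum, h]
    simp
    ring
  have hgi (n : ι → ℤ) : Integrable (g n) := GaussianFourier.integrable_cexp_neg_mul_sum_add hb _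
  have hgint (n : ι → ℤ) : ∫ y, g n y = (-Complex.I * z) ^ (-(Fintype.card ι : ℂ) / 2) *
      Complex.exp ((Real.pi : ℂ) * Complex.I *
            ((∑ j, ((Aᵀ)⁻¹.mulVec (fun i => (n i : ℝ)) j) ^ 2 : ℝ) : ℂ) * (-z⁻¹)) := by
    rw [GaussianFourier.integral_cexp_neg_mul_sum_add hb]
    congr 1
    · have : (Real.pi : ℂ) / -(Real.pi * Complex.I * z) = (-Complex.I * z)⁻¹ := by
        have := Complex.ofReal_ne_zero.mpr Real.pi_ne_zero
        field_simp
      rw [this, Complex.inv_cpow, neg_div, Complex.cpow_neg]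
      exact Complex.slitPlane_arg_ne_pi (Or.inl (by simpa using hz))
    · congr 1
      push_cast
      have hsq (w : ℂ) : (-2 * Real.pi * Complex.I * w) ^ 2 = -4 * Real.pi ^ 2 * w ^ 2 := by
        linear_combination (4 * Real.pi ^ 2 * w ^ 2) * Complex.I_sq
      simp_rw [hsq, ← Finset.mul_sum]
      have := Complex.ofReal_ne_zero.mpr Real.pi_ne_zero
      field_simp
      simp only [Complex.I_sq]
      ring
  have hfc : Continuous f := by fun_prop
  have hfi : Integrable f := by
    have h := hmp.integrable_comp_of_integrable (hgi 0)
    refine h.congr (.of_forall fun y => ?_)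
    simp [← hgf]
  have hbd : ∀ R : ℝ, ∃ u : (ι → ℤ) → ℝ, Summable u ∧
      ∀ m x, ‖x‖ ≤ R → ‖f (x + fun i => (m i : ℝ))‖ ≤ u m := by
    intro R
    obtain ⟨u, hu, h⟩ := exists_summable_bound_exp_neg_sum_mulVec_sq hAu
      (mul_pos Real.pi_pos hz) R
    refine ⟨u, hu, fun m x hx => ?_⟩
    rw [norm_exp_pi_mul_I_mul_ofReal_mul]
    exact h m x hx
  have hcoeff (n : ι → ℤ) :
      ∫ y : ι → ℝ, Complex.exp (2 * Real.pi * Complex.I * ∑ i, ((-n) i : ℂ) * y i) * f y =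
        ∫ y, g n y := by
    simp_rw [hgf]
    exact hmp.integral_comp hme (g n)
  have hs : Summable fun n => ∫ y, g n y := by
    obtain ⟨u, hu, h⟩ := exists_summable_bound_exp_neg_sum_mulVec_sq hBu
      (mul_pos Real.pi_pos hzinv) 0
    simp_rw [hgint]
    refine Summable.mul_left _ ?_
    refine Summable.of_norm_bounded hu fun n => ?_
    rw [norm_exp_pi_mul_I_mul_ofReal_mul]
    simpa using h n 0 (by simp)
  have hfx (y : ι → ℝ) : Complex.exp (Real.pi * Complex.I *
      ((∑ j, (A.mulVec y j) ^ 2 : ℝ) : ℂ) * z) = f y := rfl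
  clear_value f g
  simp_rw [hfx]
  have key := tsum_add_int_eq_tsum_fourier hfc hfi hbd hcoeff hs x
  simp_rw [hgint] at key
  rw [key, ← tsum_mul_left]
  refine tsum_congr fun n => ?_
  rw [hadj, mul_assoc, ← Complex.exp_add]
  push_cast
  rfl

theorem exists_eq_mul_map_intCast_of_range_subset {ι : Type*} [Fintype ι] [DecidableEq ι]
    {A B : Matrix ι ι ℝ}
    (h : (Set.range fun m : ι → ℤ => A.mulVec fun i => (m i : ℝ)) ⊆
      Set.range fun k : ι → ℤ => B.mulVec fun i => (k i : ℝ)) :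
    ∃ U : Matrix ι ι ℤ, A = B * U.map fun k : ℤ => (k : ℝ) := by
  have h' (i : ι) : ∃ u : ι → ℤ, B.mulVec (fun j => (u j : ℝ)) = A.col i := by
    obtain ⟨u, hu⟩ := h ⟨Pi.single i 1, rfl⟩
    refine ⟨u, hu.trans ?_⟩
    have hcast : (fun j => ((Pi.single i 1 : ι → ℤ) j : ℝ)) = Pi.single i 1 := by
      ext j
      simp [Pi.single_apply]
    beta_reduce
    rw [hcast, Matrix.mulVec_single_one]
  choose u hu using h'
  refine ⟨Matrix.of fun j i => u i j, ?_⟩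
  ext j i
  exact (congrFun (hu i) j).symm

theorem abs_det_eq_one_of_range_eq_dual {ι : Type*} [Fintype ι] [DecidableEq ι]
    {A : Matrix ι ι ℝ} (hA : IsUnit A.det)
    (hself : (Set.range fun m : ι → ℤ => A.mulVec fun i => (m i : ℝ)) =
      Set.range fun k : ι → ℤ => (Aᵀ)⁻¹.mulVec fun i => (k i : ℝ)) :
    |A.det| = 1 := by
  obtain ⟨U, hU⟩ := exists_eq_mul_map_intCast_of_range_subset hself.subset
  obtain ⟨V, hV⟩ := exists_eq_mul_map_intCast_of_range_subset hself.superset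
  have hdet (W : Matrix ι ι ℤ) : (W.map fun k : ℤ => (k : ℝ)).det = (W.det : ℝ) :=
    ((Int.castRingHom ℝ).map_det W).symm
  replace hU := congrArg Matrix.det hU
  replace hV := congrArg Matrix.det hV
  rw [Matrix.det_mul, Matrix.det_nonsing_inv, Matrix.det_transpose, Ring.inverse_eq_inv', hdet]
    at hU hV
  have h0 := hA.ne_zero
  have hU' : A.det ^ 2 = U.det := by
    field_simp at hU
    exact hU
  have hV' : A.det ^ 2 * V.det = 1 := by
    field_simp at hV
    exact hV.symm
  have hpos : 0 < U.det := by
    have : 0 < A.det ^ 2 := by positivity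
    rw [hU'] at this
    exact_mod_cast this
  rw [hU'] at hV'
  have hUV : U.det * V.det = 1 := by exact_mod_cast hV'
  have hU1 : U.det = 1 := Int.eq_one_of_mul_eq_one_right hpos.le hUV
  rw [hU1, Int.cast_one] at hU'
  rw [← abs_one, ← sq_eq_sq_iff_abs_eq_abs, hU', one_pow]

theorem tsum_mulVec_intCast_eq_of_range_eq {ι : Type*} [Fintype ι] [DecidableEq ι]
    {A B : Matrix ι ι ℝ} (hA : IsUnit A.det) (hB : IsUnit B.det)
    (h : (Set.range fun m : ι → ℤ => A.mulVec fun i => (m i : ℝ)) =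
      Set.range fun k : ι → ℤ => B.mulVec fun i => (k i : ℝ)) (G : (ι → ℝ) → ℂ) :
    ∑' m : ι → ℤ, G (A.mulVec fun i => (m i : ℝ)) =
      ∑' m : ι → ℤ, G (B.mulVec fun i => (m i : ℝ)) := by
  have hinj {C : Matrix ι ι ℝ} (hC : IsUnit C.det) :
      Function.Injective fun m : ι → ℤ => C.mulVec fun i => (m i : ℝ) :=
    (Matrix.mulVec_injective_of_isUnit ((Matrix.isUnit_iff_isUnit_det C).mpr hC)).comp
      fun m n hmn => funext fun i => Int.cast_injective (congrFun hmn i)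
  rw [← tsum_range G (hinj hA), ← tsum_range G (hinj hB), h]

/-- The theta inversion formula with characteristic `A x` on a self-dual lattice. -/
theorem tsum_exp_mulVec_add_sq_eq_of_self_dual {ι : Type*} [Fintype ι] [DecidableEq ι]
    {A : Matrix ι ι ℝ} (hA : IsUnit A.det)
    (hself : (Set.range fun m : ι → ℤ => A.mulVec fun i => (m i : ℝ)) =
      Set.range fun k : ι → ℤ => (Aᵀ)⁻¹.mulVec fun i => (k i : ℝ))
    {z : ℂ} (hz : 0 < z.im) (x : ι → ℝ) :
    ∑' m : ι → ℤ, Complex.exp ((Real.pi : ℂ) * Complex.I *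
        ((∑ j, (A.mulVec (fun i => (m i : ℝ)) j + A.mulVec x j) ^ 2 : ℝ) : ℂ) * z) =
      (-Complex.I * z) ^ (-(Fintype.card ι : ℂ) / 2) *
        ∑' m : ι → ℤ, Complex.exp ((Real.pi : ℂ) * Complex.I *
            ((∑ j, (A.mulVec (fun i => (m i : ℝ)) j) ^ 2 : ℝ) : ℂ) * (-z⁻¹) +
          2 * (Real.pi : ℂ) * Complex.I *
            ((∑ j, A.mulVec (fun i => (m i : ℝ)) j * A.mulVec x j : ℝ) : ℂ)) := by
  have hB : IsUnit ((Aᵀ)⁻¹).det := by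
    rwa [Matrix.isUnit_nonsing_inv_det_iff, Matrix.det_transpose]
  rw [tsum_mulVec_intCast_eq_of_range_eq hA hB hself fun w => Complex.exp ((Real.pi : ℂ) *
      Complex.I * ((∑ j, w j ^ 2 : ℝ) : ℂ) * (-z⁻¹) +
    2 * (Real.pi : ℂ) * Complex.I * ((∑ j, w j * A.mulVec x j : ℝ) : ℂ)),
    ← tsum_exp_mulVec_sq_eq (abs_det_eq_one_of_range_eq_dual hA hself) hz]
  simp_rw [Matrix.mulVec_add, Pi.add_apply, add_comm]

/-- **Transformation law of the generalized Dedekind eta function** (slice form of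
Theorem 4.20): for a self-dual lattice `L = A·ℤ^d` and `q̃ = (1/2)·A·m₀`, the function
`η_q̃ = θ·θ̃_q̃·θ̃̃_q̃` satisfies `η_q̃(z) = (−iz)^{−3d/2} η_q̃(−z⁻¹)` for `Im z > 0`. -/
theorem eta_transformation (d : ℕ) (hd : 1 ≤ d)
    (A : Matrix (Fin d) (Fin d) ℝ) (hA : IsUnit A.det)
    (hself : (Set.range fun m : Fin d → ℤ => A.mulVec fun i => (m i : ℝ))
      = Set.range fun k : Fin d → ℤ => (Aᵀ)⁻¹.mulVec fun i => (k i : ℝ))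
    (m₀ : Fin d → ℤ) (qt : Fin d → ℝ)
    (hqt : qt = (1 / 2 : ℝ) • A.mulVec fun i => (m₀ i : ℝ))
    (θ θ₁ θ₂ η : ℂ → ℂ)
    (hθ : ∀ z : ℂ, 0 < z.im → θ z = ∑' m : Fin d → ℤ,
      Complex.exp ((Real.pi : ℂ) * Complex.I *
        ((∑ j, (A.mulVec (fun i => (m i : ℝ)) j) ^ 2 : ℝ) : ℂ) * z))
    (hθ₁ : ∀ z : ℂ, 0 < z.im → θ₁ z = ∑' m : Fin d → ℤ,
      Complex.exp ((Real.pi : ℂ) * Complex.I *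
          ((∑ j, (A.mulVec (fun i => (m i : ℝ)) j) ^ 2 : ℝ) : ℂ) * z
        + 2 * (Real.pi : ℂ) * Complex.I *
          ((∑ j, A.mulVec (fun i => (m i : ℝ)) j * qt j : ℝ) : ℂ)))
    (hθ₂ : ∀ z : ℂ, 0 < z.im → θ₂ z = ∑' m : Fin d → ℤ,
      Complex.exp ((Real.pi : ℂ) * Complex.I *
        ((∑ j, (A.mulVec (fun i => (m i : ℝ)) j + qt j) ^ 2 : ℝ) : ℂ) * z))
    (hη : ∀ z : ℂ, 0 < z.im → η z = θ z * θ₁ z * θ₂ z)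
    (z : ℂ) (hz : 0 < z.im) :
    η z = (-Complex.I * z) ^ (-(3 * d : ℂ) / 2) * η (-z⁻¹) := by
  have hz0 : z ≠ 0 := by
    rintro rfl
    simp at hz
  have hzinv : 0 < (-z⁻¹).im := by
    rw [Complex.neg_im, Complex.inv_im, neg_div, neg_neg]
    exact div_pos hz (Complex.normSq_pos.mpr hz0)
  have hw0 : -Complex.I * z ≠ 0 := by simp [hz0]
  have hq : A.mulVec ((1 / 2 : ℝ) • fun i => (m₀ i : ℝ)) = qt := by
    rw [Matrix.mulVec_smul, hqt]
  have h₀ : θ z = (-Complex.I * z) ^ (-(d : ℂ) / 2) * θ (-z⁻¹) := by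
    have h := tsum_exp_mulVec_add_sq_eq_of_self_dual hA hself hz 0
    rw [hθ z hz, hθ _ hzinv]
    simpa using h
  have h₂ {w : ℂ} (hw : 0 < w.im) (hw' : 0 < (-w⁻¹).im) :
      θ₂ w = (-Complex.I * w) ^ (-(d : ℂ) / 2) * θ₁ (-w⁻¹) := by
    have h := tsum_exp_mulVec_add_sq_eq_of_self_dual hA hself hw
      ((1 / 2 : ℝ) • fun i => (m₀ i : ℝ))
    rw [hq, Fintype.card_fin] at h
    rw [hθ₂ w hw, hθ₁ _ hw', h]
  have h₁ : θ₁ z = (-Complex.I * z) ^ (-(d : ℂ) / 2) * θ₂ (-z⁻¹) := by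
    have hinv : -(-z⁻¹)⁻¹ = z := by simp
    have hmul : -Complex.I * -z⁻¹ = (-Complex.I * z)⁻¹ := by
      rw [mul_inv, inv_neg, Complex.inv_I]
      ring
    have harg : (-Complex.I * z).arg ≠ Real.pi :=
      Complex.slitPlane_arg_ne_pi (Or.inl (by simpa using hz))
    rw [h₂ hzinv (by rwa [hinv]), hinv, hmul, Complex.inv_cpow _ _ harg, ← mul_assoc,
      mul_inv_cancel₀ (Complex.cpow_ne_zero_iff_of_exponent_ne_zero (by
        simp; omega) |>.mpr hw0), one_mul]
  have hpow : (-Complex.I * z) ^ (-(3 * d : ℂ) / 2) =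
      ((-Complex.I * z) ^ (-(d : ℂ) / 2)) ^ 3 := by
    rw [← Complex.cpow_nat_mul]
    congr 1
    push_cast
    ring
  rw [hη z hz, hη _ hzinv, hpow, h₀, h₁, h₂ hz hzinv]
  ring
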